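/- Fix 0 < ε < 1/4 and n ≥ 1, and let X = {1_0,…,n_0} ∪ {1_1,…,n_1} be a set of 2n elements. For z ∈ {−1,+1}^n let D^{(z)} be the distribution on X assigning probability (1 − ε·z_i)/(2n) to i_0 and probability (1 + ε·z_i)/(2n) to i_1 for each i ∈ {1,…,n}. There is an absolute constant c > 0 such that any function 𝒜 : X^N → {−1,+1}^n with the property that for every z ∈ {−1,+1}^n, with probability at least 3/4 over x ∼ (D^{(z)})^N the output satisfies Σ_{i=1}^n 1[𝒜(x)_i ≠ z_i] ≤ n/4, must satisfy N ≥ c·n/ε². -/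

import Mathlib

open scoped BigOperators

/-- An agent type in the hidden-action principal-agent model with `n` actions and
`m` outcomes: a production function `f` (a distribution over outcomes for each action)
and a nonnegative cost vector `c` with `c 0 = 0`. -/
structure AgentType (n m : ℕ) where
  f : Fin n → Fin m → ℝ
  c : Fin n → ℝ
  f_nonneg : ∀ i j, 0 ≤ f i j
  f_sum : ∀ i, ∑ j, f i j = 1
  c_nonneg : ∀ i, 0 ≤ c i
  c_zero : ∀ i : Fin n, (i : ℕ) = 0 → c i = 0

/-- The agent's expected utility for action `i` under contract `t`. -/
def uA {n m : ℕ} (θ : AgentType n m) (t : Fin m → ℝ) (i : Fin n) : ℝ :=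
  (∑ j, θ.f i j * t j) - θ.c i

/-- The principal's expected utility when the agent takes action `i` under contract `t`,
with rewards `r`. -/
def uPa {n m : ℕ} (r : Fin m → ℝ) (θ : AgentType n m) (t : Fin m → ℝ) (i : Fin n) : ℝ :=
  ∑ j, θ.f i j * (r j - t j)

/-- The set of the agent's best-response actions to contract `t`. -/
def BestResp {n m : ℕ} (θ : AgentType n m) (t : Fin m → ℝ) : Set (Fin n) :=
  {i | ∀ i', uA θ t i' ≤ uA θ t i}

/-- The principal's utility under contract `t`: the agent best-responds, breaking ties
in favor of the principal. -/
noncomputable def uP {n m : ℕ} (r : Fin m → ℝ) (θ : AgentType n m) (t : Fin m → ℝ) : ℝ :=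
  sSup (uPa r θ t '' BestResp θ t)

/-- The class of linear contracts `α • r`, `α ∈ [0,1]`. -/
def Clinear {m : ℕ} (r : Fin m → ℝ) : Set (Fin m → ℝ) :=
  {t | ∃ α : ℝ, α ∈ Set.Icc (0:ℝ) 1 ∧ t = fun j => α * r j}

/-- The class of bounded contracts `[0,1]^m`. -/
def Cbounded (m : ℕ) : Set (Fin m → ℝ) := {t | ∀ j, t j ∈ Set.Icc (0:ℝ) 1}

/-- The class of unbounded contracts `ℝ_{≥0}^m`. -/
def Cunbounded (m : ℕ) : Set (Fin m → ℝ) := {t | ∀ j, 0 ≤ t j}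

/-- A finitely supported probability distribution. -/
structure FinDist (α : Type*) where
  p : α → ℝ
  nonneg : ∀ a, 0 ≤ p a
  finite_support : (Function.support p).Finite
  total : ∑ᶠ a, p a = 1

/-- Expectation of `g` under a finitely supported distribution `D`. -/
noncomputable def expect {α : Type*} (D : FinDist α) (g : α → ℝ) : ℝ :=
  ∑ᶠ a, D.p a * g a

/-- `OPT(C, D)`: the supremum over contracts in `C` of the principal's expected utility. -/
noncomputable def OPT {n m : ℕ} (C : Set (Fin m → ℝ)) (r : Fin m → ℝ)
    (D : FinDist (AgentType n m)) : ℝ :=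
  sSup ((fun t => expect D (fun θ => uP r θ t)) '' C)

/-- Pseudo-dimension shattering: `C` shatters some `k` types in `Θ`. -/
def Shatters {n m : ℕ} (r : Fin m → ℝ) (C : Set (Fin m → ℝ))
    (Θ : Set (AgentType n m)) (k : ℕ) : Prop :=
  ∃ θ : Fin k → AgentType n m, (∀ j, θ j ∈ Θ) ∧ ∃ τ : Fin k → ℝ,
    ∀ S : Finset (Fin k), ∃ t ∈ C,
      (∀ j, j ∈ S → τ j ≤ uP r (θ j) t) ∧ (∀ j, j ∉ S → uP r (θ j) t < τ j)

/-- `Cbar` is an `ε`-approximation of `C` (representation error at most `ε`). -/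
def IsApprox (n : ℕ) {m : ℕ} (r : Fin m → ℝ) (Cbar C : Set (Fin m → ℝ)) (ε : ℝ) : Prop :=
  ∀ D : FinDist (AgentType n m), OPT Cbar r D ≥ OPT C r D - ε

/-- Best responses breaking ties in favor of the principal. -/
def BestRespP {n m : ℕ} (r : Fin m → ℝ) (θ : AgentType n m) (t : Fin m → ℝ) : Set (Fin n) :=
  {i | i ∈ BestResp θ t ∧ ∀ i' ∈ BestResp θ t, uPa r θ t i' ≤ uPa r θ t i}

/-- Principal's expected reward under the linear contract `α • r`. -/
noncomputable def rP {n m : ℕ} (r : Fin m → ℝ) (θ : AgentType n m) (α : ℝ) : ℝ :=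
  sSup ((fun i => ∑ j, θ.f i j * r j) '' BestRespP r θ (fun j => α * r j))

/-- The set of critical values of an agent type for linear contracts. -/
def CritSet {n m : ℕ} (r : Fin m → ℝ) (θ : AgentType n m) : Set ℝ :=
  {α | α ∈ Set.Ioc (0:ℝ) 1 ∧ ∀ ε : ℝ, 0 < ε → ε ≤ α → rP r θ (α - ε) ≠ rP r θ α}

/-- Probability of the event `E` under `N` i.i.d. samples from `D`. -/
noncomputable def prodProb {α : Type*} (D : FinDist α) (N : ℕ) (E : Set (Fin N → α)) : ℝ :=
  ∑ᶠ s ∈ E, ∏ i, D.p (s i)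

/-- The class of `ε`-discrete linear contracts. -/
def Leps {m : ℕ} (r : Fin m → ℝ) (ε : ℝ) : Set (Fin m → ℝ) :=
  {t | ∃ α : ℝ, ((∃ k : ℕ, α = k * ε ∧ k * ε ≤ 1) ∨ α = 1) ∧ t = fun j => α * r j}

/-- Probability of an event under `N` i.i.d. samples from a pmf `q` on a type `α`. -/
noncomputable def prodProbPmf {α : Type*} (q : α → ℝ) (N : ℕ) (E : Set (Fin N → α)) : ℝ :=
  ∑ᶠ x ∈ E, ∏ i, q (x i)

/-- Sign of a Boolean, encoding `{−1,+1}` by `Bool`. -/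
def sgn (b : Bool) : ℝ := if b then 1 else -1

/-- The distribution `D^{(z)}` on the `2n`-element set `Fin n × Bool` (element `i_b`
gets probability `(1 + ε·z_i·(±1))/(2n)`). -/
noncomputable def Dz (n : ℕ) (ε : ℝ) (z : Fin n → Bool) : Fin n × Bool → ℝ :=
  fun x => (1 + ε * sgn (z x.1) * sgn x.2) / (2 * n)

lemma prodProbPmf_eq_sum {α : Type*} [Fintype α] (q : α → ℝ) (N : ℕ)
    (E : Set (Fin N → α)) :
    prodProbPmf q N E = ∑ x, (∏ k, q (x k)) * E.indicator 1 x := by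
  classical
  unfold prodProbPmf
  rw [finsum_mem_def, finsum_eq_sum_of_fintype]
  refine Finset.sum_congr rfl fun x _ => ?_
  by_cases hx : x ∈ E <;> simp [hx]

/-- A chi-square bound on how well a test bounded by `1/2` distinguishes two product
distributions. -/
lemma sq_sum_prod_sub_prod_mul_le {α : Type*} [Fintype α] {p q : α → ℝ}
    (hp : ∀ a, 0 < p a) (hp_sum : ∑ a, p a = 1) (hq_sum : ∑ a, q a = 1) (N : ℕ)
    (h : (Fin N → α) → ℝ) (hh : ∀ x, h x ^ 2 = 1 / 4) :
    (∑ x : Fin N → α, (∏ k, p (x k) - ∏ k, q (x k)) * h x) ^ 2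
      ≤ ((∑ a, q a ^ 2 / p a) ^ N - 1) / 4 := by
  have hP : ∀ x : Fin N → α, 0 < ∏ k, p (x k) := fun x => Finset.prod_pos fun k _ => hp _
  have hP_sum : ∑ x : Fin N → α, ∏ k, p (x k) = 1 := by
    rw [← Fintype.sum_pow, hp_sum, one_pow]
  have hQ_sum : ∑ x : Fin N → α, ∏ k, q (x k) = 1 := by
    rw [← Fintype.sum_pow, hq_sum, one_pow]
  have hchi : ∑ x : Fin N → α, (∏ k, p (x k) - ∏ k, q (x k)) ^ 2 / ∏ k, p (x k)
      = (∑ a, q a ^ 2 / p a) ^ N - 1 := by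
    have hterm : ∀ x : Fin N → α, (∏ k, p (x k) - ∏ k, q (x k)) ^ 2 / ∏ k, p (x k)
        = ∏ k, p (x k) - 2 * ∏ k, q (x k) + ∏ k, q (x k) ^ 2 / p (x k) := by
      intro x
      have := (hP x).ne'
      rw [Finset.prod_div_distrib, Finset.prod_pow]
      field_simp
      ring
    rw [Finset.sum_congr rfl fun x _ => hterm x, Finset.sum_add_distrib,
      Finset.sum_sub_distrib, ← Finset.mul_sum, hP_sum, hQ_sum, Fintype.sum_pow]
    ring
  calc _ ≤ (∑ x : Fin N → α, (∏ k, p (x k) - ∏ k, q (x k)) ^ 2 / ∏ k, p (x k)) *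
        ∑ x : Fin N → α, (∏ k, p (x k)) * (1 / 4) := by
        refine Finset.sum_sq_le_sum_mul_sum_of_sq_le_mul _
          (fun x _ => div_nonneg (sq_nonneg _) (hP x).le)
          (fun x _ => mul_nonneg (hP x).le (by norm_num)) fun x _ => ?_
        have := (hP x).ne'
        rw [mul_pow, hh]
        apply le_of_eq
        field_simp
    _ = _ := by
        rw [hchi, ← Finset.sum_mul, hP_sum]
        ring

lemma Dz_pos {n : ℕ} (hn : 1 ≤ n) {ε : ℝ} (h0 : 0 < ε) (h1 : ε < 1 / 4)
    (z : Fin n → Bool) (x : Fin n × Bool) : 0 < Dz n ε z x := by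
  have : (0 : ℝ) < n := by exact_mod_cast hn
  unfold Dz
  refine div_pos ?_ (by positivity)
  cases z x.1 <;> cases x.2 <;> simp [sgn] <;> linarith

lemma sum_Dz {n : ℕ} (hn : 1 ≤ n) (ε : ℝ) (z : Fin n → Bool) :
    ∑ x, Dz n ε z x = 1 := by
  have : (n : ℝ) ≠ 0 := by
    have : n ≠ 0 := by lia
    exact_mod_cast this
  have hfiber : ∀ i : Fin n, ∑ b, Dz n ε z (i, b) = 1 / n := by
    intro i
    simp only [Fintype.sum_bool, Dz, sgn]
    simp only [if_true, Bool.false_eq_true, if_false]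
    field_simp
    ring
  rw [Fintype.sum_prod_type, Finset.sum_congr rfl fun i _ => hfiber i]
  simp [this]

/-- Flip the `i`-th coordinate of a Boolean vector. -/
def flipAt {n : ℕ} (i : Fin n) (z : Fin n → Bool) : Fin n → Bool :=
  Function.update z i (!z i)

lemma flipAt_involutive {n : ℕ} (i : Fin n) : Function.Involutive (flipAt i) := by
  intro z
  simp [flipAt]

lemma sum_Dz_flipAt_sq_div_le {n : ℕ} (hn : 1 ≤ n) {ε : ℝ} (h0 : 0 < ε)
    (h1 : ε < 1 / 4) (z : Fin n → Bool) (i : Fin n) :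
    ∑ x, Dz n ε (flipAt i z) x ^ 2 / Dz n ε z x ≤ 1 + 5 * ε ^ 2 / n := by
  have hn' : (0 : ℝ) < n := by exact_mod_cast hn
  have hplus : (0 : ℝ) < 1 + ε := by linarith
  have hminus : (0 : ℝ) < 1 - ε := by linarith
  have hfiber : ∀ j : Fin n, ∑ b, Dz n ε (flipAt i z) (j, b) ^ 2 / Dz n ε z (j, b)
      ≤ 1 / n + if j = i then 5 * ε ^ 2 / n else 0 := by
    intro j
    by_cases hj : j = i
    · subst hj
      have hval : ((1 - ε) / (2 * n)) ^ 2 / ((1 + ε) / (2 * n))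
          + ((1 + ε) / (2 * n)) ^ 2 / ((1 - ε) / (2 * n))
          ≤ 1 / (n : ℝ) + 5 * ε ^ 2 / n := by
        have hrw : ((1 - ε) / (2 * n)) ^ 2 / ((1 + ε) / (2 * n))
          + ((1 + ε) / (2 * n)) ^ 2 / ((1 - ε) / (2 * n))
          = ((1 + 3 * ε ^ 2) / ((1 + ε) * (1 - ε))) / (n : ℝ) := by
          field_simp
          ring
        rw [hrw, ← add_div]
        gcongr
        rw [div_le_iff₀ (by positivity)]
        have : ε ^ 2 ≤ 1 / 16 := by nlinarith
        nlinarith [sq_nonneg ε]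
      cases hz : z j <;>
        simp [Dz, sgn, flipAt, hz, ← sub_eq_add_neg] <;>
        simp only [one_div] at hval <;> linarith
    · have hD : ∀ b, Dz n ε (flipAt i z) (j, b) = Dz n ε z (j, b) := by
        intro b
        simp [Dz, flipAt, Function.update_of_ne hj]
      have hsq : ∀ b, Dz n ε z (j, b) ^ 2 / Dz n ε z (j, b) = Dz n ε z (j, b) := by
        intro b
        have := (Dz_pos hn h0 h1 z (j, b)).ne'
        field_simp
      simp only [hD, hsq, hj, if_false, add_zero]
      apply le_of_eq
      simp only [Fintype.sum_bool, Dz, sgn]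
      simp only [if_true, Bool.false_eq_true, if_false]
      field_simp
      ring
  rw [Fintype.sum_prod_type]
  refine (Finset.sum_le_sum fun j _ => hfiber j).trans ?_
  simp [Finset.sum_add_distrib, hn'.ne']

/-- The probability that the algorithm `𝒜` errs on coordinate `i` when the truth is `z`. -/
noncomputable def coordError {n N : ℕ} (ε : ℝ)
    (𝒜 : (Fin N → Fin n × Bool) → (Fin n → Bool)) (z : Fin n → Bool) (i : Fin n) : ℝ :=
  ∑ x, (∏ k, Dz n ε z (x k)) * if 𝒜 x i ≠ z i then 1 else 0

lemma sum_prod_Dz {n : ℕ} (hn : 1 ≤ n) (ε : ℝ) (z : Fin n → Bool) (N : ℕ) :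
    ∑ x : Fin N → Fin n × Bool, ∏ k, Dz n ε z (x k) = 1 := by
  rw [← Fintype.sum_pow, sum_Dz hn, one_pow]

lemma coordError_add_coordError_flipAt {n N : ℕ} (hn : 1 ≤ n) {ε : ℝ} (h0 : 0 < ε)
    (h1 : ε < 1 / 4) (hN : (N : ℝ) < 1 / 100 * n / ε ^ 2)
    (𝒜 : (Fin N → Fin n × Bool) → (Fin n → Bool)) (z : Fin n → Bool) (i : Fin n) :
    7 / 8 < coordError ε 𝒜 z i + coordError ε 𝒜 (flipAt i z) i := by
  have hn' : (0 : ℝ) < n := by exact_mod_cast hn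
  set h : (Fin N → Fin n × Bool) → ℝ := fun x => if 𝒜 x i ≠ z i then -(1 / 2) else 1 / 2
    with hh_def
  have hsq := sq_sum_prod_sub_prod_mul_le (Dz_pos hn h0 h1 z) (sum_Dz hn ε z)
    (sum_Dz hn ε (flipAt i z)) N h fun x => by
      simp only [hh_def]
      split_ifs <;> norm_num
  have hsum : coordError ε 𝒜 z i + coordError ε 𝒜 (flipAt i z) i
      = 1 - ∑ x : Fin N → Fin n × Bool,
        (∏ k, Dz n ε z (x k) - ∏ k, Dz n ε (flipAt i z) (x k)) * h x := by
    have hone : (1 : ℝ) = ∑ x : Fin N → Fin n × Bool,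
        (∏ k, Dz n ε z (x k) + ∏ k, Dz n ε (flipAt i z) (x k)) / 2 := by
      rw [← Finset.sum_div, Finset.sum_add_distrib, sum_prod_Dz hn, sum_prod_Dz hn]
      norm_num
    rw [hone, coordError, coordError, ← Finset.sum_add_distrib, ← Finset.sum_sub_distrib]
    refine Finset.sum_congr rfl fun x _ => ?_
    have hflip : flipAt i z i = !z i := by simp [flipAt]
    simp only [hh_def, hflip]
    cases 𝒜 x i <;> cases z i <;> simp <;> ring
  have hchi : (∑ x, Dz n ε (flipAt i z) x ^ 2 / Dz n ε z x) ^ N ≤ 20 / 19 := by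
    have hx : (N : ℝ) * (5 * ε ^ 2 / n) ≤ 1 / 20 := by
      rw [lt_div_iff₀ (by positivity)] at hN
      rw [← mul_div_assoc, div_le_iff₀ hn']
      linarith
    calc _ ≤ (1 + 5 * ε ^ 2 / n) ^ N := by
          gcongr
          · exact Finset.sum_nonneg fun x _ =>
              div_nonneg (sq_nonneg _) (Dz_pos hn h0 h1 z x).le
          · exact sum_Dz_flipAt_sq_div_le hn h0 h1 z i
      _ ≤ Real.exp (5 * ε ^ 2 / n) ^ N := by
          gcongr
          linarith [Real.add_one_le_exp (5 * ε ^ 2 / n)]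
      _ = Real.exp (N * (5 * ε ^ 2 / n)) := (Real.exp_nat_mul _ N).symm
      _ ≤ Real.exp (1 / 20) := Real.exp_le_exp.2 hx
      _ ≤ 20 / 19 := by
          have hpos := Real.exp_pos (1 / 20)
          have hinv := Real.add_one_le_exp (-(1 / 20))
          rw [Real.exp_neg] at hinv
          have := mul_le_mul_of_nonneg_right hinv hpos.le
          rw [inv_mul_cancel₀ hpos.ne'] at this
          linarith
  rw [hsum]
  nlinarith

lemma sum_coordError_le {n N : ℕ} (hn : 1 ≤ n) {ε : ℝ} (h0 : 0 < ε) (h1 : ε < 1 / 4)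
    (𝒜 : (Fin N → Fin n × Bool) → (Fin n → Bool)) (z : Fin n → Bool)
    (hz : prodProbPmf (Dz n ε z) N
      {x | ((Finset.univ.filter (fun i => 𝒜 x i ≠ z i)).card : ℝ) ≤ (n : ℝ)/4} ≥ 3/4) :
    ∑ i, coordError ε 𝒜 z i ≤ 7 / 16 * n := by
  classical
  have hn' : (0 : ℝ) < n := by exact_mod_cast hn
  rw [prodProbPmf_eq_sum] at hz
  set E : Set (Fin N → Fin n × Bool) :=
    {x | ((Finset.univ.filter (fun i => 𝒜 x i ≠ z i)).card : ℝ) ≤ (n : ℝ)/4} with hE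
  calc ∑ i, coordError ε 𝒜 z i
      = ∑ x, (∏ k, Dz n ε z (x k)) *
          ((Finset.univ.filter (fun i => 𝒜 x i ≠ z i)).card : ℝ) := by
        simp only [coordError]
        rw [Finset.sum_comm]
        refine Finset.sum_congr rfl fun x _ => ?_
        rw [← Finset.mul_sum, Finset.sum_boole]
    _ ≤ ∑ x, (n * (∏ k, Dz n ε z (x k)) -
          3 / 4 * n * ((∏ k, Dz n ε z (x k)) * E.indicator 1 x)) := by
        refine Finset.sum_le_sum fun x _ => ?_
        have hP : 0 < ∏ k, Dz n ε z (x k) :=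
          Finset.prod_pos fun k _ => Dz_pos hn h0 h1 z (x k)
        have hcard : ((Finset.univ.filter (fun i => 𝒜 x i ≠ z i)).card : ℝ)
            ≤ n - 3 / 4 * n * E.indicator 1 x := by
          by_cases hx : x ∈ E
          · have : ((Finset.univ.filter (fun i => 𝒜 x i ≠ z i)).card : ℝ) ≤ (n : ℝ)/4 := hx
            rw [Set.indicator_of_mem hx, Pi.one_apply]
            linarith
          · rw [Set.indicator_of_notMem hx, mul_zero, sub_zero]
            have := Finset.card_le_univ (Finset.univ.filter (fun i => 𝒜 x i ≠ z i))
            rw [Fintype.card_fin] at this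
            exact_mod_cast this
        have := mul_le_mul_of_nonneg_left hcard hP.le
        linarith
    _ ≤ 7 / 16 * n := by
        rw [Finset.sum_sub_distrib, ← Finset.mul_sum, ← Finset.mul_sum, sum_prod_Dz hn]
        nlinarith

/-- There is an absolute constant `c > 0` such that any algorithm that,
for every `z ∈ {−1,+1}^n`, given `N` i.i.d. samples from `D^{(z)}`, recovers `z` up to
`n/4` mistakes with probability at least `3/4`, must use `N ≥ c·n/ε²` samples. -/
theorem stmt_15 : ∃ c : ℝ, 0 < c ∧
    ∀ (n : ℕ), 1 ≤ n → ∀ ε : ℝ, 0 < ε → ε < 1/4 →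
    ∀ N : ℕ, ∀ 𝒜 : (Fin N → Fin n × Bool) → (Fin n → Bool),
      (∀ z : Fin n → Bool,
        prodProbPmf (Dz n ε z) N
          {x | ((Finset.univ.filter (fun i => 𝒜 x i ≠ z i)).card : ℝ) ≤ (n : ℝ)/4}
          ≥ 3/4) →
      (N : ℝ) ≥ c * n / ε^2 := by
  refine ⟨1 / 100, by norm_num, fun n hn ε h0 h1 N 𝒜 h𝒜 => ?_⟩
  by_contra hN
  rw [ge_iff_le, not_le] at hN
  have hn' : (0 : ℝ) < n := by exact_mod_cast hn
  have hcoord : ∀ i : Fin n,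
      7 / 16 * (Fintype.card (Fin n → Bool) : ℝ) < ∑ z, coordError ε 𝒜 z i := by
    intro i
    have hflip : ∑ z, coordError ε 𝒜 (flipAt i z) i = ∑ z, coordError ε 𝒜 z i :=
      Equiv.sum_comp (flipAt_involutive i).toPerm fun z => coordError ε 𝒜 z i
    have hlt : ∑ _z : Fin n → Bool, (7 / 8 : ℝ)
        < ∑ z, (coordError ε 𝒜 z i + coordError ε 𝒜 (flipAt i z) i) :=
      Finset.sum_lt_sum_of_nonempty Finset.univ_nonempty fun z _ =>
        coordError_add_coordError_flipAt hn h0 h1 hN 𝒜 z i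
    rw [Finset.sum_add_distrib, hflip, Finset.sum_const, Finset.card_univ,
      nsmul_eq_mul] at hlt
    linarith
  have hlower : ∑ _i : Fin n, 7 / 16 * (Fintype.card (Fin n → Bool) : ℝ)
      < ∑ i, ∑ z, coordError ε 𝒜 z i :=
    Finset.sum_lt_sum_of_nonempty ⟨⟨0, hn⟩, Finset.mem_univ _⟩ fun i _ => hcoord i
  have hupper : ∑ z, ∑ i, coordError ε 𝒜 z i ≤ ∑ _z : Fin n → Bool, 7 / 16 * (n : ℝ) :=
    Finset.sum_le_sum fun z _ => sum_coordError_le hn h0 h1 𝒜 z (h𝒜 z)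
  rw [Finset.sum_comm] at hupper
  simp only [Finset.sum_const, Finset.card_univ, nsmul_eq_mul, Fintype.card_fin]
    at hlower hupper
  linarith
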